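/- arXiv:1602.02748 — 3 statements merged into one kernel-verified Lean document; each statement's English description precedes it below -/
import Mathlib

section
/- Let A and B be bounded linear operators on a complex Hilbert space such that A and AB are normal and BA is normal. Then A*AB = BA*A. -/
open ContinuousLinearMap
open scoped InnerProductSpace

variable {H : Type*} [NormedAddCommGroup H] [InnerProductSpace ℂ H] [CompleteSpace H]

/-- If A, AB and BA are normal, then A*AB = BA*A. -/
theorem stmt1 (A B : H →L[ℂ] H)
    (hA : adjoint A * A = A * adjoint A)
    (hAB : adjoint (A * B) * (A * B) = (A * B) * adjoint (A * B))
    (hBA : adjoint (B * A) * (B * A) = (B * A) * adjoint (B * A)) :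
    adjoint A * A * B = B * (adjoint A * A) := by
  have h1 : SemiconjBy A (B * A) (A * B) := (mul_assoc A B A).symm
  have h2 := fuglede_putnam_rosenblum ⟨hBA⟩ ⟨hAB⟩ h1
  have h3 : A * star (B * A) = star (A * B) * A := h2
  rw [star_mul, star_mul] at h3
  have h4 := congrArg star h3
  simp only [star_mul, star_star] at h4
  rw [← star_eq_adjoint] at hA ⊢
  calc star A * A * B = B * (A * star A) := by simpa [mul_assoc] using h4.symm
    _ = B * (star A * A) := by rw [hA]
end

section
/- Let A and B be bounded operators on a complex Hilbert space with A quasihyponormal and B hyponormal. If [B*,A] = 0, A*[B*,B]B = 0 and B*[A*,A]B = 0, then for every complex number ω the operator T = ωA + B is quasihyponormal. -/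
open ContinuousLinearMap
open scoped InnerProductSpace

variable {H : Type*} [NormedAddCommGroup H] [InnerProductSpace ℂ H] [CompleteSpace H]

/-- `T T* + ε`. -/
noncomputable def regM (T : H →L[ℂ] H) (ε : ℝ) : H →L[ℂ] H := T * adjoint T + (ε : ℂ) • 1

/-- `(T T* + ε)⁻¹`. -/
noncomputable def regR (T : H →L[ℂ] H) (ε : ℝ) : H →L[ℂ] H := Ring.inverse (regM T ε)

lemma regM_apply (T : H →L[ℂ] H) (ε : ℝ) (u : H) :
    regM T ε u = T (adjoint T u) + (ε : ℂ) • u := rfl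

lemma regM_inner (T : H →L[ℂ] H) (ε : ℝ) (u : H) :
    ⟪regM T ε u, u⟫_ℂ = ((‖adjoint T u‖ ^ 2 + ε * ‖u‖ ^ 2 : ℝ) : ℂ) := by
  simp only [regM_apply, inner_add_left, inner_smul_left]
  rw [← adjoint_inner_right T, inner_self_eq_norm_sq_to_K, inner_self_eq_norm_sq_to_K]
  simp

lemma regM_isUnit (T : H →L[ℂ] H) {ε : ℝ} (hε : 0 < ε) : IsUnit (regM T ε) := by
  refine isUnit_of_forall_le_norm_inner_map _ (c := ⟨ε, hε.le⟩) hε fun x => ?_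
  rw [regM_inner, Complex.norm_real]
  refine le_trans ?_ (le_abs_self _)
  have := sq_nonneg ‖adjoint T x‖
  change ‖x‖ ^ 2 * ε ≤ _
  nlinarith

lemma regM_regR (T : H →L[ℂ] H) {ε : ℝ} (hε : 0 < ε) : regM T ε * regR T ε = 1 :=
  Ring.mul_inverse_cancel _ (regM_isUnit T hε)

lemma regR_regM (T : H →L[ℂ] H) {ε : ℝ} (hε : 0 < ε) : regR T ε * regM T ε = 1 :=
  Ring.inverse_mul_cancel _ (regM_isUnit T hε)

lemma regM_adj (T : H →L[ℂ] H) (ε : ℝ) : adjoint (regM T ε) = regM T ε := by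
  simp only [← star_eq_adjoint, regM]
  simp

lemma regR_inner (T : H →L[ℂ] H) {ε : ℝ} (hε : 0 < ε) (x y : H) :
    ⟪regR T ε x, y⟫_ℂ = ⟪x, regR T ε y⟫_ℂ := by
  have h1 : ∀ x, regM T ε (regR T ε x) = x := fun x => by
    simpa using DFunLike.congr_fun (regM_regR T hε) x
  conv_rhs => rw [← h1 x]
  rw [← adjoint_inner_right (regM T ε), regM_adj, h1]

lemma regM_apply_regR (T : H →L[ℂ] H) {ε : ℝ} (hε : 0 < ε) (y : H) :
    regM T ε (regR T ε y) = y := by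
  simpa using DFunLike.congr_fun (regM_regR T hε) y

lemma regR_energy (T : H →L[ℂ] H) {ε : ℝ} (hε : 0 < ε) (y : H) :
    ⟪y, regR T ε y⟫_ℂ =
      ((‖adjoint T (regR T ε y)‖ ^ 2 + ε * ‖regR T ε y‖ ^ 2 : ℝ) : ℂ) := by
  rw [← regM_inner, regM_apply_regR T hε]

/-- the regularised resolvent identity -/
lemma reg_key (T : H →L[ℂ] H) {ε : ℝ} (hε : 0 < ε) :
    adjoint T * regR T ε * T = 1 - (ε : ℂ) • regR (adjoint T) ε := by
  have h1 : T * regM (adjoint T) ε = regM T ε * T := by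
    simp [regM, mul_add, add_mul, mul_assoc]
  have h2 : regR T ε * T = T * regR (adjoint T) ε := by
    calc regR T ε * T = regR T ε * (T * regM (adjoint T) ε) * regR (adjoint T) ε := by
          rw [mul_assoc, mul_assoc, regM_regR _ hε, mul_one]
      _ = T * regR (adjoint T) ε := by
          rw [h1, ← mul_assoc, regR_regM _ hε, one_mul]
  have h3 := regM_regR (adjoint T) hε
  rw [mul_assoc, h2, ← h3]
  simp [regM, add_mul, mul_assoc]

lemma reg_bound1 (T : H →L[ℂ] H) {ε : ℝ} (hε : 0 < ε) (y : H) {C : ℝ} (hC : 0 ≤ C)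
    (h : ∀ x, ‖⟪y, x⟫_ℂ‖ ≤ C * ‖adjoint T x‖) :
    (⟪y, regR T ε y⟫_ℂ).re ≤ C ^ 2 := by
  have h1 := h (regR T ε y)
  rw [regR_energy T hε, Complex.norm_real] at h1
  rw [regR_energy T hε, Complex.ofReal_re]
  have h2 := (le_abs_self _).trans h1
  have h3 : 0 ≤ ε * ‖regR T ε y‖ ^ 2 := by positivity
  nlinarith [sq_nonneg (‖adjoint T (regR T ε y)‖ - C), norm_nonneg (adjoint T (regR T ε y))]

lemma reg_bound2 (T : H →L[ℂ] H) {ε : ℝ} (hε : 0 < ε) (y : H) {C : ℝ} (hC : 0 ≤ C)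
    (h : ∀ x, ‖⟪y, x⟫_ℂ‖ ≤ C * ‖adjoint T x‖) (hT : ∀ x, ‖adjoint T x‖ ≤ ‖T x‖) :
    ε * ‖regR (adjoint T) ε y‖ ^ 2 ≤ C ^ 2 := by
  have h1 := h (regR (adjoint T) ε y)
  rw [regR_energy _ hε, Complex.norm_real, adjoint_adjoint] at h1
  have h2 := (le_abs_self _).trans h1
  have h4 := hT (regR (adjoint T) ε y)
  nlinarith [sq_nonneg (‖T (regR (adjoint T) ε y)‖ - C), norm_nonneg (T (regR (adjoint T) ε y)),
    mul_le_mul_of_nonneg_left h4 hC]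

lemma reg_step (T : H →L[ℂ] H) {ε : ℝ} (hε : 0 < ε) (y : H) :
    ε / 2 * ‖regR T ε y‖ ^ 2 ≤ (⟪y, regR T (ε/2) y⟫_ℂ).re - (⟪y, regR T ε y⟫_ℂ).re := by
  set u := regR T ε y with hu
  set w := regR T (ε/2) y with hw
  have hd : 0 < ε / 2 := by positivity
  have e1 : regM T ε u = y := regM_apply_regR T hε y
  have e2 : regM T (ε/2) w = y := regM_apply_regR T hd y
  have e3 : regM T (ε/2) (w - u) = ((ε/2 : ℝ) : ℂ) • u := by
    have : regM T ε u = regM T (ε/2) u + ((ε/2 : ℝ) : ℂ) • u := by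
      simp only [regM_apply, add_assoc, ← add_smul]
      congr 2; push_cast; ring
    rw [map_sub, e2, ← e1, this]; abel
  have e4 : ⟪y, w⟫_ℂ - ⟪y, u⟫_ℂ = ((ε/2 : ℝ) : ℂ) * ⟪w, u⟫_ℂ := by
    rw [← inner_sub_right, ← e2, ← adjoint_inner_right, regM_adj, e3, inner_smul_right]
  have e5 := regM_inner T (ε/2) (w - u)
  rw [e3, inner_smul_left, Complex.conj_ofReal, inner_sub_right] at e5
  have e6 := congrArg Complex.re e4
  have e7 := congrArg Complex.re e5
  have e8 : (⟪u, w⟫_ℂ).re = (⟪w, u⟫_ℂ).re := by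
    rw [← inner_conj_symm, Complex.conj_re]
  have e9 : (⟪u, u⟫_ℂ).re = ‖u‖ ^ 2 := by
    rw [inner_self_eq_norm_sq_to_K]; norm_cast
  rw [Complex.re_ofReal_mul, Complex.sub_re, e8, e9, Complex.ofReal_re] at e7
  rw [Complex.re_ofReal_mul, Complex.sub_re] at e6
  have : 0 ≤ ‖adjoint T (w - u)‖ ^ 2 + ε / 2 * ‖w - u‖ ^ 2 := by positivity
  nlinarith

lemma reg_sum (T : H →L[ℂ] H) (y : H) {C : ℝ} (hC : 0 ≤ C)
    (h : ∀ x, ‖⟪y, x⟫_ℂ‖ ≤ C * ‖adjoint T x‖) (n : ℕ) :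
    ∑ k ∈ Finset.range n, (1/2 : ℝ) ^ k * ‖regR T ((1/2 : ℝ) ^ k) y‖ ^ 2 ≤ 2 * C ^ 2 := by
  have key : ∀ n : ℕ, ∑ k ∈ Finset.range n, (1/2 : ℝ) ^ k * ‖regR T ((1/2 : ℝ) ^ k) y‖ ^ 2
      ≤ 2 * (⟪y, regR T ((1/2 : ℝ) ^ n) y⟫_ℂ).re := by
    intro n
    induction n with
    | zero =>
      rw [regR_energy T (by norm_num), Complex.ofReal_re]
      simp only [Finset.range_zero, Finset.sum_empty]
      positivity
    | succ n ih =>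
      rw [Finset.sum_range_succ]
      have := reg_step T (ε := (1/2 : ℝ) ^ n) (by positivity) y
      have e : (1/2 : ℝ) ^ (n+1) = (1/2 : ℝ) ^ n / 2 := by ring
      rw [e]
      linarith
  refine (key n).trans ?_
  have := reg_bound1 T (ε := (1/2 : ℝ) ^ n) (by positivity) y hC h
  linarith

lemma reg_derivT (h : H →L[ℂ] H) (z : ℂ) :
    ∃ F' : ℂ →L[ℝ] (H →L[ℂ] H), HasFDerivAt (fun z : ℂ => (h - z • 1 : H →L[ℂ] H)) F' z ∧
      ∀ d, F' d = -(d • 1) := by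
  refine ⟨-((ContinuousLinearMap.id ℝ ℂ).smulRight (1 : H →L[ℂ] H)), ?_, fun d => by simp⟩
  exact (((ContinuousLinearMap.id ℝ ℂ).smulRight (1 : H →L[ℂ] H)).hasFDerivAt
      (x := z)).const_sub h

lemma adj_sub_smul (h : H →L[ℂ] H) (z : ℂ) :
    adjoint (h - z • 1) = adjoint h - (starRingEnd ℂ z) • 1 := by
  simp only [← star_eq_adjoint]
  simp

lemma reg_derivTa (h : H →L[ℂ] H) (z : ℂ) :
    ∃ F' : ℂ →L[ℝ] (H →L[ℂ] H),
      HasFDerivAt (fun z : ℂ => (adjoint (h - z • 1) : H →L[ℂ] H)) F' z ∧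
      ∀ d, F' d = -((starRingEnd ℂ d) • 1) := by
  refine ⟨-((Complex.conjCLE : ℂ →L[ℝ] ℂ).smulRight (1 : H →L[ℂ] H)), ?_, fun d => by simp⟩
  have := (((Complex.conjCLE : ℂ →L[ℝ] ℂ).smulRight (1 : H →L[ℂ] H)).hasFDerivAt
      (x := z)).const_sub (adjoint h)
  refine this.congr_of_eventuallyEq (Filter.Eventually.of_forall fun z => ?_)
  exact adj_sub_smul h z

lemma hasFDerivAt_mul_ex {𝔸 : Type*} [NormedRing 𝔸] [NormedAlgebra ℝ 𝔸] {a b : ℂ → 𝔸}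
    {a' b' : ℂ →L[ℝ] 𝔸} {z : ℂ} (ha : HasFDerivAt a a' z) (hb : HasFDerivAt b b' z) :
    ∃ F' : ℂ →L[ℝ] 𝔸, HasFDerivAt (fun z => a z * b z) F' z ∧
      ∀ d, F' d = a z * b' d + a' d * b z :=
  ⟨_, ha.mul' hb, fun d => rfl⟩

lemma hasFDerivAt_inv_ex {𝔸 : Type*} [NormedRing 𝔸] [NormedAlgebra ℝ 𝔸] [CompleteSpace 𝔸]
    {a : ℂ → 𝔸} {a' : ℂ →L[ℝ] 𝔸} {z : ℂ} (ha : HasFDerivAt a a' z) (hu : IsUnit (a z)) :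
    ∃ F' : ℂ →L[ℝ] 𝔸, HasFDerivAt (fun z => Ring.inverse (a z)) F' z ∧
      ∀ d, F' d = -(Ring.inverse (a z) * a' d * Ring.inverse (a z)) := by
  obtain ⟨U, hU⟩ := hu
  have hI := hasFDerivAt_ringInverse (𝕜 := ℝ) U
  have hUi : ((U⁻¹ : 𝔸ˣ) : 𝔸) = Ring.inverse (a z) := by
    rw [← hU, Ring.inverse_unit]
  rw [hU] at hI
  refine ⟨_, hI.comp z ha, fun d => ?_⟩
  rw [← hUi]
  simp [mulLeftRight_apply]

lemma reg_derivR (h : H →L[ℂ] H) {ε : ℝ} (hε : 0 < ε) (z : ℂ) :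
    ∃ F' : ℂ →L[ℝ] (H →L[ℂ] H),
      HasFDerivAt (fun z : ℂ => regR (h - z • 1) ε) F' z ∧
      ∀ d : ℂ, F' d = regR (h - z • 1) ε * (d • adjoint (h - z • 1) +
        (starRingEnd ℂ d) • (h - z • 1)) * regR (h - z • 1) ε := by
  obtain ⟨T', hT, hT'⟩ := reg_derivT h z
  obtain ⟨Ta', hTa, hTa'⟩ := reg_derivTa h z
  obtain ⟨M', hM, hM'⟩ := hasFDerivAt_mul_ex hT hTa
  obtain ⟨R', hR, hR'⟩ := hasFDerivAt_inv_ex (hM.add_const ((ε : ℂ) • (1 : H →L[ℂ] H)))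
    (regM_isUnit (h - z • 1) hε)
  refine ⟨R', hR, fun d => ?_⟩
  rw [hR', hM', hT', hTa']
  change -(regR _ ε * _ * regR _ ε) = _
  rw [← neg_mul, ← mul_neg]
  congr 2
  rw [mul_neg, neg_mul, mul_smul_comm, smul_mul_assoc, mul_one, one_mul]
  abel

lemma reg_deriv (h : H →L[ℂ] H) {ε : ℝ} (hε : 0 < ε) (y : H) (z : ℂ) :
    ∃ F' : ℂ →L[ℝ] ℂ,
      HasFDerivAt (fun z : ℂ => ⟪y, adjoint (h - z • 1) (regR (h - z • 1) ε y)⟫_ℂ) F' z ∧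
      Complex.I • F' 1 - F' Complex.I =
        -2 * Complex.I * ε * ⟪regR (adjoint (h - z • 1)) ε y, regR (h - z • 1) ε y⟫_ℂ := by
  obtain ⟨Ta', hTa, hTa'⟩ := reg_derivTa h z
  obtain ⟨R', hR, hR'⟩ := reg_derivR h hε z
  obtain ⟨P', hP, hP'⟩ := hasFDerivAt_mul_ex hTa hR
  let ev : (H →L[ℂ] H) →L[ℝ] ℂ :=
    ((innerSL ℂ y).comp (ContinuousLinearMap.apply ℂ H y)).restrictScalars ℝ
  have ev1 : ∀ X, ev X = ⟪y, X y⟫_ℂ := fun X => rfl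
  refine ⟨ev.comp P', ev.hasFDerivAt.comp z hP, ?_⟩
  have hk := reg_key (h - z • 1) hε
  rw [regR_inner _ hε]
  have hk2 : (adjoint (h - z • 1)) ((regR (h - z • 1) ε) ((h - z • 1) (regR (h - z • 1) ε y)))
    = regR (h - z • 1) ε y - (ε : ℂ) • regR (adjoint (h - z • 1)) ε (regR (h - z • 1) ε y) :=
    DFunLike.congr_fun hk (regR (h - z • 1) ε y)
  have main : ∀ d : ℂ, (ev.comp P') d = 
      d * ⟪y, adjoint (h - z • 1) (regR (h - z • 1) ε (adjoint (h - z • 1)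
        (regR (h - z • 1) ε y)))⟫_ℂ 
      - (starRingEnd ℂ d) * (ε * ⟪y, regR (adjoint (h - z • 1)) ε (regR (h - z • 1) ε y)⟫_ℂ) := by
    intro d
    change ev (P' d) = _
    rw [ev1, hP', hR', hTa']
    generalize h - z • (1 : H →L[ℂ] H) = T at *
    have : (adjoint T * (regR T ε * (d • adjoint T + (starRingEnd ℂ d) • T) * regR T ε)
        + -((starRingEnd ℂ d) • 1) * regR T ε) y =
        d • adjoint T (regR T ε (adjoint T (regR T ε y))) +
        (starRingEnd ℂ d) • (adjoint T (regR T ε (T (regR T ε y))))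
          - (starRingEnd ℂ d) • regR T ε y := by
      have e : (adjoint T * (regR T ε * (d • adjoint T + (starRingEnd ℂ d) • T) * regR T ε)
        + -((starRingEnd ℂ d) • 1) * regR T ε) y =
        adjoint T (regR T ε (d • adjoint T (regR T ε y) + (starRingEnd ℂ d) • T (regR T ε y)))
        + -((starRingEnd ℂ d) • regR T ε y) := rfl
      rw [e]
      simp only [map_add, map_smul]
      abel
    rw [this, hk2]
    simp only [inner_add_right, inner_sub_right, inner_smul_right]
    ring
  rw [main, main]
  simp
  ring

lemma hypo_shift (h : H →L[ℂ] H) (hh : ∀ x, ‖adjoint h x‖ ≤ ‖h x‖) (z : ℂ) (x : H) :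
    ‖adjoint (h - z • 1) x‖ ≤ ‖(h - z • 1) x‖ := by
  rw [adj_sub_smul]
  refine le_of_sq_le_sq ?_ (norm_nonneg _)
  change ‖adjoint h x - (starRingEnd ℂ z) • x‖ ^ 2 ≤ ‖h x - z • x‖ ^ 2
  rw [@norm_sub_sq ℂ, @norm_sub_sq ℂ]
  have e1 : RCLike.re ⟪adjoint h x, (starRingEnd ℂ z) • x⟫_ℂ = RCLike.re ⟪h x, z • x⟫_ℂ := by
    rw [inner_smul_right, inner_smul_right, adjoint_inner_left, ← inner_conj_symm x (h x),
      ← map_mul]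
    exact RCLike.conj_re _
  rw [e1, norm_smul, norm_smul, RCLike.norm_conj]
  have := pow_le_pow_left₀ (norm_nonneg _) (hh x) 2
  linarith

lemma reg_boundary (h : H →L[ℂ] H) {ε : ℝ} (hε : 0 < ε) (hε1 : ε ≤ 1) (y : H) (z : ℂ)
    (hz : 5 * ‖h‖ + 4 ≤ ‖z‖) :
    ‖z * ⟪y, adjoint (h - z • 1) (regR (h - z • 1) ε y)⟫_ℂ + (‖y‖ ^ 2 : ℝ)‖ ≤ ‖y‖ ^ 2 / 4 := by
  set u := regR (h - z • 1) ε y with hu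
  set p := adjoint (h - z • 1) u with hp
  have e1 : (h - z • 1) p + (ε : ℂ) • u = y := by
    have := regM_apply_regR (h - z • 1) hε y
    rwa [regM_apply] at this
  have e2 : z • p = h p + (ε : ℂ) • u - y := by
    rw [← e1]
    change _ = h p + (ε : ℂ) • u - ((h p - z • p) + (ε : ℂ) • u)
    abel
  have e3 : z * ⟪y, p⟫_ℂ + (‖y‖ ^ 2 : ℝ) = ⟪y, h p + (ε : ℂ) • u⟫_ℂ := by
    rw [← inner_smul_right, e2, inner_sub_right, inner_self_eq_norm_sq_to_K]
    push_cast
    exact sub_add_cancel _ _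
  have hs : 0 ≤ ‖h‖ := norm_nonneg h
  have hpu : (4 * ‖h‖ + 4) * ‖u‖ ≤ ‖p‖ := by
    rw [hp, adj_sub_smul]
    change _ ≤ ‖adjoint h u - (starRingEnd ℂ z) • u‖
    have h1 := norm_sub_norm_le ((starRingEnd ℂ z) • u) (adjoint h u)
    rw [norm_sub_rev, norm_smul, RCLike.norm_conj] at h1
    have h2 := (adjoint h).le_opNorm u
    rw [LinearIsometryEquiv.norm_map] at h2
    nlinarith [norm_nonneg u]
  have hen : ‖p‖ ^ 2 ≤ ‖y‖ * ‖u‖ := by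
    have h1 := norm_inner_le_norm (𝕜 := ℂ) y u
    rw [hu, regR_energy _ hε, Complex.norm_real] at h1
    have h2 := (le_abs_self _).trans h1
    have : 0 ≤ ε * ‖u‖ ^ 2 := by positivity
    rw [← hu, ← hp] at h2
    linarith
  have hp2 : (4 * ‖h‖ + 4) * ‖p‖ ≤ ‖y‖ := by
    by_contra hcon
    push Not at hcon
    have hp0 : 0 < ‖p‖ := by
      rcases (norm_nonneg p).eq_or_lt with h0 | h0
      · rw [← h0] at hcon; nlinarith [norm_nonneg y]
      · exact h0
    nlinarith [norm_nonneg y, norm_nonneg u]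
  rw [e3]
  refine (norm_inner_le_norm _ _).trans ?_
  have h5 : ‖h p + (ε : ℂ) • u‖ ≤ ‖h‖ * ‖p‖ + ‖u‖ := by
    refine (norm_add_le _ _).trans (add_le_add (h.le_opNorm p) ?_)
    rw [norm_smul, Complex.norm_real, Real.norm_eq_abs, abs_of_pos hε]
    nlinarith [norm_nonneg u]
  have h6 : ‖h‖ * ‖p‖ + ‖u‖ ≤ ‖y‖ / 4 := by nlinarith [norm_nonneg u, norm_nonneg p]
  nlinarith [norm_nonneg y]

lemma bd_point (z f : ℂ) {r Y : ℝ} (hr : 0 < r) (hY : 0 ≤ Y) (h1 : z.re = r) (h2 : |z.im| ≤ r)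
    (h : ‖z * f + (Y : ℂ)‖ ≤ Y / 4) : f.re ≤ -(Y / (4 * r)) := by
  have a1 := (Complex.abs_re_le_norm _).trans h
  have a2 := (Complex.abs_im_le_norm _).trans h
  simp only [Complex.add_re, Complex.mul_re, Complex.ofReal_re, Complex.add_im, Complex.mul_im,
    Complex.ofReal_im, h1, add_zero] at a1 a2
  set s := z.im
  set e1 := r * f.re - s * f.im + Y with he1
  set e2 := r * f.im + s * f.re with he2
  have id1 : (r ^ 2 + s ^ 2) * f.re = r * e1 + s * e2 - r * Y := by rw [he1, he2]; ring
  have b1 : r * e1 ≤ r * (Y / 4) := mul_le_mul_of_nonneg_left ((le_abs_self _).trans a1) hr.le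
  have b2 : s * e2 ≤ r * (Y / 4) := by
    refine (le_abs_self _).trans ?_
    rw [abs_mul]
    exact mul_le_mul h2 a2 (abs_nonneg _) hr.le
  have b3 : s ^ 2 ≤ r ^ 2 := sq_le_sq.2 (by rwa [abs_of_pos hr])
  have b4 : (r ^ 2 + s ^ 2) * f.re ≤ -(r * Y / 2) := by linarith
  rw [← neg_div, le_div_iff₀ (by positivity)]
  by_contra hcon
  push Not at hcon
  have b5 : (r ^ 2 + s ^ 2) * (f.re * (4 * r)) ≤ -(2 * r ^ 2 * Y) := by nlinarith
  have b6 : (r ^ 2 + s ^ 2) * (-Y) < (r ^ 2 + s ^ 2) * (f.re * (4 * r)) :=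
    mul_lt_mul_of_pos_left hcon (by positivity)
  nlinarith

lemma rect_bound (f : ℂ → ℂ) (f' : ℂ → ℂ →L[ℝ] ℂ) (g : ℂ → ℂ) {r Y K : ℝ} (hr : 0 < r)
    (hY : 0 ≤ Y) (hd : ∀ z, HasFDerivAt f (f' z) z)
    (hg : ∀ z, Complex.I • f' z 1 - f' z Complex.I = g z) (gc : Continuous g)
    (hK : ∀ z, ‖g z‖ ≤ K)
    (hb : ∀ z, r ≤ ‖z‖ → ‖z * f z + (Y : ℂ)‖ ≤ Y / 4) : 2 * Y ≤ K * (2 * r) * (2 * r) := by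
  have fc : Continuous f := continuous_iff_continuousAt.2 fun z => (hd z).continuousAt
  have key := Complex.integral_boundary_rect_of_hasFDerivAt_real_off_countable f f'
    ⟨-r, -r⟩ ⟨r, r⟩ ∅ Set.countable_empty fc.continuousOn (fun z _ => hd z) (by
      simp only [hg]
      exact gc.continuousOn.integrableOn_compact (isCompact_uIcc.reProdIm isCompact_uIcc))
  simp only [hg] at key
  have i1 : ∀ c : ℂ, IntervalIntegrable (fun x : ℝ => f (x + c)) MeasureTheory.volume (-r) r :=
    fun c => (by fun_prop : Continuous fun x : ℝ => f (x + c)).intervalIntegrable _ _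
  have i2 : ∀ c : ℂ, IntervalIntegrable (fun x : ℝ => Complex.I • f (c + x * Complex.I))
      MeasureTheory.volume (-r) r :=
    fun c => (by fun_prop : Continuous fun x : ℝ =>
      Complex.I • f (c + x * Complex.I)).intervalIntegrable _ _
  rw [← intervalIntegral.integral_smul, ← intervalIntegral.integral_smul,
    ← intervalIntegral.integral_sub (i1 _) (i1 _),
    ← intervalIntegral.integral_add ((i1 _).sub (i1 _)) (i2 _),
    ← intervalIntegral.integral_sub (((i1 _).sub (i1 _)).add (i2 _)) (i2 _)] at key
  have hR : ‖∫ x : ℝ in (-r)..r, ∫ y : ℝ in (-r)..r, g (x + y * Complex.I)‖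
      ≤ K * (2 * r) * (2 * r) := by
    have e : |r - -r| = 2 * r := by rw [abs_of_pos (by linarith)]; ring
    refine (intervalIntegral.norm_integral_le_of_norm_le_const (C := K * (2 * r)) ?_).trans
      (by rw [e])
    intro x _
    refine (intervalIntegral.norm_integral_le_of_norm_le_const (C := K) ?_).trans
      (by rw [e])
    intro y _
    exact hK _
  rw [← key] at hR
  have hI := (Complex.abs_im_le_norm _).trans hR
  have him : ∀ F : ℝ → ℂ, IntervalIntegrable F MeasureTheory.volume (-r) r →
      (∫ x in (-r)..r, F x).im = ∫ x in (-r)..r, (F x).im := fun F hF =>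
    (Complex.imCLM.intervalIntegral_comp_comm hF).symm
  have hint := (((i1 (((-r : ℝ) : ℂ) * Complex.I)).sub (i1 ((r : ℂ) * Complex.I))).add
    (i2 (r : ℂ))).sub (i2 ((-r : ℝ) : ℂ))
  have h1 := him _ hint
  have hle : (∫ x in (-r)..r, ((f (↑x + ((-r : ℝ) : ℂ) * Complex.I) - f (↑x + (r : ℂ) * Complex.I)
      + Complex.I • f ((r : ℂ) + x * Complex.I)) - Complex.I • f (((-r : ℝ) : ℂ) + x * Complex.I)).im)
      ≤ ∫ x in (-r)..r, (-(Y / r)) := by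
    refine intervalIntegral.integral_mono_on (by linarith) 
      (Continuous.intervalIntegrable (by fun_prop) _ _) (by simp) ?_
    intro x hx
    have hx' : |x| ≤ r := abs_le.2 hx
    have c1 := bd_point (Complex.I * (↑x + ((-r : ℝ) : ℂ) * Complex.I))
      (-Complex.I * f (↑x + ((-r : ℝ) : ℂ) * Complex.I)) hr hY (by simp) (by simpa using hx') (by
        convert hb (↑x + ((-r : ℝ) : ℂ) * Complex.I) ?_ using 2
        · linear_combination (-(↑x + ((-r : ℝ) : ℂ) * Complex.I) * f (↑x + ((-r : ℝ) : ℂ) * Complex.I)) * Complex.I_mul_I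
        · refine le_trans ?_ (Complex.abs_im_le_norm _)
          simp [abs_of_pos hr])
    have c2 := bd_point (-Complex.I * (↑x + (r : ℂ) * Complex.I))
      (Complex.I * f (↑x + (r : ℂ) * Complex.I)) hr hY (by simp) (by simpa using hx') (by
        convert hb (↑x + (r : ℂ) * Complex.I) ?_ using 2
        · linear_combination (-(↑x + (r : ℂ) * Complex.I) * f (↑x + (r : ℂ) * Complex.I)) * Complex.I_mul_I
        · refine le_trans ?_ (Complex.abs_im_le_norm _)
          simp [abs_of_pos hr])
    have c3 := bd_point ((r : ℂ) + x * Complex.I) (f ((r : ℂ) + x * Complex.I)) hr hY (by simp)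
      (by simpa using hx') (hb _ (by
          refine le_trans ?_ (Complex.abs_re_le_norm _)
          simp [abs_of_pos hr]))
    have c4 := bd_point (-(((-r : ℝ) : ℂ) + x * Complex.I)) (-f (((-r : ℝ) : ℂ) + x * Complex.I))
      hr hY (by simp) (by simpa using hx') (by
        rw [neg_mul_neg]
        exact hb _ (by
          refine le_trans ?_ (Complex.abs_re_le_norm _)
          simp [abs_of_pos hr]))
    have e : Y / r = 4 * (Y / (4 * r)) := by field_simp
    rw [e]
    simp only [neg_mul, Complex.neg_re, Complex.I_mul_re, Complex.sub_im, Complex.add_im,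
      smul_eq_mul, Complex.I_mul_im] at c1 c2 c3 c4 ⊢
    linarith
  rw [intervalIntegral.integral_const, smul_eq_mul] at hle
  have e2 : (r - -r) * -(Y / r) = -(2 * Y) := by field_simp; ring
  rw [e2, ← h1] at hle
  have := (abs_le.1 hI).1
  refine le_of_neg_le_neg (this.trans ?_)
  exact hle

lemma regR_cont (h : H →L[ℂ] H) {ε : ℝ} (hε : 0 < ε) :
    Continuous fun z : ℂ => regR (h - z • 1) ε :=
  continuous_iff_continuousAt.2 fun z => by
    obtain ⟨F', hF, _⟩ := reg_derivR h hε z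
    exact hF.continuousAt

lemma regR_cont' (h : H →L[ℂ] H) {ε : ℝ} (hε : 0 < ε) :
    Continuous fun z : ℂ => regR (adjoint (h - z • 1)) ε := by
  simp only [adj_sub_smul]
  exact (regR_cont (adjoint h) hε).comp Complex.continuous_conj

lemma claim (h : H →L[ℂ] H) (hh : ∀ x, ‖adjoint h x‖ ≤ ‖h x‖) (y : H) {C : ℝ} (hC : 0 ≤ C)
    (hy : ∀ (z : ℂ) x, ‖⟪y, x⟫_ℂ‖ ≤ C * ‖adjoint (h - z • 1) x‖) : y = 0 := by
  set r : ℝ := 5 * ‖h‖ + 4 with hr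
  have hr0 : 0 < r := by positivity
  have hε : ∀ k : ℕ, 0 < (1/2 : ℝ) ^ k := fun k => by positivity
  choose F' hF hF' using fun (k : ℕ) (z : ℂ) => reg_deriv h (hε k) y z
  have main : ∀ n : ℕ, 2 * (n * ‖y‖ ^ 2) ≤ (2 * C * √(n * (2 * C ^ 2))) * (2 * r) * (2 * r) := by
    intro n
    refine rect_bound 
      (fun z => ∑ k ∈ Finset.range n, 
        ⟪y, adjoint (h - z • 1) (regR (h - z • 1) ((1/2 : ℝ) ^ k) y)⟫_ℂ)
      (fun z => ∑ k ∈ Finset.range n, F' k z)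
      (fun z => ∑ k ∈ Finset.range n, (-2 * Complex.I * ((1/2 : ℝ) ^ k : ℝ) *
        ⟪regR (adjoint (h - z • 1)) ((1/2 : ℝ) ^ k) y, regR (h - z • 1) ((1/2 : ℝ) ^ k) y⟫_ℂ))
      hr0 (by positivity) (fun z => HasFDerivAt.fun_sum fun k _ => hF k z) ?_ ?_ ?_ ?_
    · intro z
      rw [_root_.sum_apply, _root_.sum_apply, Finset.smul_sum,
        ← Finset.sum_sub_distrib]
      exact Finset.sum_congr rfl fun k _ => hF' k z
    · refine continuous_finsetSum _ fun k _ => ?_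
      refine continuous_const.mul ?_
      exact ((regR_cont' h (hε k)).clm_apply continuous_const).inner
        ((regR_cont h (hε k)).clm_apply continuous_const)
    · intro z
      have s1 := reg_sum (h - z • 1) y hC (hy z) n
      have hT := hypo_shift h hh z
      have s2 := fun k => reg_bound2 (h - z • 1) (hε k) y hC (hy z) hT
      refine (norm_sum_le _ _).trans ?_
      have t1 : ∀ k ∈ Finset.range n, ‖-2 * Complex.I * (((1/2 : ℝ) ^ k : ℝ) : ℂ) *
          ⟪regR (adjoint (h - z • 1)) ((1/2 : ℝ) ^ k) y, regR (h - z • 1) ((1/2 : ℝ) ^ k) y⟫_ℂ‖ ≤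
          2 * C * (√((1/2 : ℝ) ^ k) * ‖regR (h - z • 1) ((1/2 : ℝ) ^ k) y‖) := by
        intro k _
        have u1 : √((1/2 : ℝ) ^ k) * ‖regR (adjoint (h - z • 1)) ((1/2 : ℝ) ^ k) y‖ ≤ C := by
          refine le_of_sq_le_sq ?_ hC
          rw [mul_pow, Real.sq_sqrt (hε k).le]
          exact s2 k
        have u2 := norm_inner_le_norm (𝕜 := ℂ) (regR (adjoint (h - z • 1)) ((1/2 : ℝ) ^ k) y)
          (regR (h - z • 1) ((1/2 : ℝ) ^ k) y)
        rw [norm_mul, norm_mul, norm_mul, Complex.norm_real, Complex.norm_I, norm_neg, 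
          Complex.norm_ofNat, Real.norm_eq_abs, abs_of_pos (hε k), mul_one]
        generalize ‖regR (adjoint (h - z • 1)) ((1/2 : ℝ) ^ k) y‖ = a at *
        have hb := norm_nonneg (regR (h - z • 1) ((1/2 : ℝ) ^ k) y)
        generalize ‖regR (h - z • 1) ((1/2 : ℝ) ^ k) y‖ = b at *
        generalize ‖⟪regR (adjoint (h - z • 1)) ((1/2 : ℝ) ^ k) y,
          regR (h - z • 1) ((1/2 : ℝ) ^ k) y⟫_ℂ‖ = q at *
        have hs := Real.mul_self_sqrt (hε k).le
        have hs0 := Real.sqrt_nonneg ((1/2 : ℝ) ^ k)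
        generalize √((1/2 : ℝ) ^ k) = s at *
        rw [← hs]
        calc 2 * (s * s) * _ ≤ 2 * (s * s) * (a * b) := by gcongr
          _ = 2 * (s * a) * (s * b) := by ring
          _ ≤ 2 * C * (s * b) := by gcongr
      refine (Finset.sum_le_sum t1).trans ?_
      rw [← Finset.mul_sum]
      refine mul_le_mul_of_nonneg_left ?_ (by positivity)
      refine Real.le_sqrt_of_sq_le ?_
      refine sq_sum_le_card_mul_sum_sq.trans ?_
      rw [Finset.card_range]
      refine mul_le_mul_of_nonneg_left ?_ (by positivity)
      refine le_trans (le_of_eq ?_) s1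
      refine Finset.sum_congr rfl fun k _ => ?_
      rw [mul_pow, Real.sq_sqrt (hε k).le]
    · intro z hz
      have : z * (∑ k ∈ Finset.range n, 
          ⟪y, adjoint (h - z • 1) (regR (h - z • 1) ((1/2 : ℝ) ^ k) y)⟫_ℂ) 
          + ((n * ‖y‖ ^ 2 : ℝ) : ℂ) = ∑ k ∈ Finset.range n, 
          (z * ⟪y, adjoint (h - z • 1) (regR (h - z • 1) ((1/2 : ℝ) ^ k) y)⟫_ℂ
            + (‖y‖ ^ 2 : ℝ)) := by
        rw [Finset.sum_add_distrib, Finset.mul_sum]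
        simp
      rw [this]
      refine (norm_sum_le_of_le _ (fun k _ => reg_boundary h (hε k) 
        (pow_le_one₀ (by norm_num) (by norm_num)) y z hz)).trans (le_of_eq ?_)
      simp
      ring
  by_contra hy0
  have hY : 0 < ‖y‖ ^ 2 := by have := norm_pos_iff.2 hy0; positivity
  set Y := ‖y‖ ^ 2
  have main2 : ∀ n : ℕ, (n : ℝ) * (2 * Y) ^ 2 ≤ (2 * C * (2 * r) * (2 * r)) ^ 2 * (2 * C ^ 2) := by
    intro n
    rcases Nat.eq_zero_or_pos n with h0 | h0
    · subst h0
      simp only [Nat.cast_zero, zero_mul]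
      positivity
    have hn : (0 : ℝ) < n := by exact_mod_cast h0
    have := pow_le_pow_left₀ (by positivity) (main n) 2
    have e : (2 * C * √(n * (2 * C ^ 2)) * (2 * r) * (2 * r)) ^ 2
        = n * ((2 * C * (2 * r) * (2 * r)) ^ 2 * (2 * C ^ 2)) := by
      have := Real.sq_sqrt (show (0:ℝ) ≤ n * (2 * C ^ 2) by positivity)
      linear_combination (2 * C * (2 * r) * (2 * r)) ^ 2 * this
    rw [e] at this
    have e2 : (2 * (n * Y)) ^ 2 = n * (n * (2 * Y) ^ 2) := by ring
    rw [e2] at this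
    exact le_of_mul_le_mul_left this hn
  obtain ⟨n, hn⟩ := exists_nat_gt
    ((2 * C * (2 * r) * (2 * r)) ^ 2 * (2 * C ^ 2) / (2 * Y) ^ 2)
  rw [div_lt_iff₀ (by positivity)] at hn
  exact absurd (main2 n) (not_le.2 hn)

lemma shift_pt (h : H →L[ℂ] H) (z : ℂ) (x : H) (hh : ‖adjoint h x‖ ≤ ‖h x‖) :
    ‖adjoint h x - (starRingEnd ℂ z) • x‖ ≤ ‖h x - z • x‖ := by
  refine le_of_sq_le_sq ?_ (norm_nonneg _)
  rw [@norm_sub_sq ℂ, @norm_sub_sq ℂ]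
  have e1 : RCLike.re ⟪adjoint h x, (starRingEnd ℂ z) • x⟫_ℂ = RCLike.re ⟪h x, z • x⟫_ℂ := by
    rw [inner_smul_right, inner_smul_right, adjoint_inner_left, ← inner_conj_symm x (h x),
      ← map_mul]
    exact RCLike.conj_re _
  rw [e1, norm_smul, norm_smul, RCLike.norm_conj]
  have := pow_le_pow_left₀ (norm_nonneg _) hh 2
  linarith

lemma star_lemma (A B : H →L[ℂ] H) (hA : ∀ v, ‖adjoint A (A v)‖ ≤ ‖A (A v)‖)
    (hBA : ∀ x, adjoint A (B x) = B (adjoint A x))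
    (h3 : ∀ x, ‖A (B x)‖ ≤ ‖adjoint A (B x)‖) (w : H) (hw : adjoint B w = 0) :
    adjoint B (adjoint A w) = 0 := by
  set y := adjoint B (adjoint A w) with hydef
  set C := ‖w‖ * ‖B‖ with hCdef
  have hC : 0 ≤ C := by positivity
  have hy1 : ∀ (z : ℂ) x, ‖⟪y, x⟫_ℂ‖ ≤ C * ‖adjoint A x - (starRingEnd ℂ z) • x‖ := by
    intro z x
    have e1 : ⟪y, x⟫_ℂ = ⟪w, A (B x) - z • B x⟫_ℂ := by
      have e0 : ⟪w, B x⟫_ℂ = 0 := by rw [← adjoint_inner_left, hw, inner_zero_left]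
      rw [hydef, adjoint_inner_left, adjoint_inner_left, inner_sub_right, inner_smul_right, e0]
      simp
    have e2 := shift_pt (adjoint A) (starRingEnd ℂ z) (B x) (by
      rw [adjoint_adjoint]; exact h3 x)
    rw [adjoint_adjoint, Complex.conj_conj, hBA, ← map_smul B (starRingEnd ℂ z) x, ← map_sub] at e2
    have e2' := e2.trans (B.le_opNorm _)
    rw [e1]
    refine (norm_inner_le_norm _ _).trans ?_
    rw [hCdef, mul_assoc]
    exact mul_le_mul_of_nonneg_left e2' (norm_nonneg _)
  let M : Submodule ℂ H := A.range.topologicalClosure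
  have : CompleteSpace M := (Submodule.isClosed_topologicalClosure _).completeSpace_coe
  set P : H →L[ℂ] H := M.starProjection with hP
  have hPs : adjoint P = P := isSelfAdjoint_iff'.1 (isSelfAdjoint_starProjection M)
  have hPi : ∀ u v, ⟪P u, v⟫_ℂ = ⟪u, P v⟫_ℂ := fun u v => by
    rw [← adjoint_inner_right, hPs]
  have hPP : ∀ x, P (P x) = P x := fun x =>
    Submodule.starProjection_eq_self_iff.2 (Submodule.starProjection_apply_mem M x)
  have hker : ∀ x, adjoint A (x - P x) = 0 := by
    intro x
    refine ext_inner_right ℂ fun v => ?_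
    rw [adjoint_inner_left, inner_zero_left]
    exact M.starProjection_inner_eq_zero x (A v)
      (Submodule.le_topologicalClosure _ (LinearMap.mem_range_self _ v))
  have hkerP : ∀ x, adjoint A (P x) = adjoint A x := fun x => by
    have := hker x
    rw [map_sub, sub_eq_zero] at this
    exact this.symm
  have hyP : ∀ x, ⟪y, P x⟫_ℂ = ⟪y, x⟫_ℂ := by
    intro x
    have := hy1 0 (x - P x)
    rw [hker] at this
    simp only [map_zero, zero_smul, sub_zero, norm_zero, mul_zero, norm_le_zero_iff,
      inner_sub_right, sub_eq_zero] at this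
    exact this.symm
  have hM : ∀ v ∈ M, ‖adjoint A v‖ ≤ ‖A v‖ := by
    intro v hv
    have hcl : IsClosed {v : H | ‖adjoint A v‖ ≤ ‖A v‖} :=
      isClosed_le (by fun_prop) (by fun_prop)
    refine closure_minimal ?_ hcl hv
    rintro _ ⟨u, rfl⟩
    exact hA u
  have hadj : adjoint (A * P) = P * adjoint A := by
    rw [← star_eq_adjoint, star_mul, star_eq_adjoint, star_eq_adjoint, hPs]
  refine claim (A * P) ?_ y hC ?_
  · intro x
    rw [hadj]
    change ‖P (adjoint A x)‖ ≤ ‖A (P x)‖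
    refine (M.norm_starProjection_apply_le _).trans ?_
    rw [← hkerP]
    exact hM _ (Submodule.starProjection_apply_mem M x)
  · have hne : ∀ z : ℂ, z ≠ 0 → ∀ x,
        ‖⟪y, x⟫_ℂ‖ ≤ C * ‖P (adjoint A x) - (starRingEnd ℂ z) • x‖ := by
      intro z hz x
      have hz' : starRingEnd ℂ z ≠ 0 := by simpa using hz
      set c := starRingEnd ℂ z
      have k1 := hy1 z (P x + c⁻¹ • (adjoint A x - P (adjoint A x)))
      have k2 : ⟪y, P x + c⁻¹ • (adjoint A x - P (adjoint A x))⟫_ℂ = ⟪y, x⟫_ℂ := by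
        rw [inner_add_right, inner_smul_right, inner_sub_right, hyP, hyP]
        simp
      have k3 : adjoint A (P x + c⁻¹ • (adjoint A x - P (adjoint A x))) -
          c • (P x + c⁻¹ • (adjoint A x - P (adjoint A x))) = P (P (adjoint A x) - c • x) := by
        rw [map_add, map_smul, hker, smul_zero, add_zero, hkerP, smul_add, smul_smul,
          mul_inv_cancel₀ hz', one_smul, map_sub, hPP, map_smul]
        abel
      rw [k2, k3] at k1
      refine k1.trans (mul_le_mul_of_nonneg_left (M.norm_starProjection_apply_le _) hC)
    intro z x
    rw [adj_sub_smul, hadj]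
    change ‖⟪y, x⟫_ℂ‖ ≤ C * ‖P (adjoint A x) - (starRingEnd ℂ z) • x‖
    have hcl : IsClosed {z : ℂ | ‖⟪y, x⟫_ℂ‖ ≤ C * ‖P (adjoint A x) - (starRingEnd ℂ z) • x‖} :=
      isClosed_le continuous_const (by fun_prop)
    have hdense : closure {z : ℂ | z ≠ 0} = Set.univ := (dense_compl_singleton (0 : ℂ)).closure_eq
    exact closure_minimal (fun z hz => hne z hz x) hcl (hdense ▸ Set.mem_univ z)

open scoped ComplexOrder in
lemma norm_of_nonneg (A : H →L[ℂ] H)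
    (hA : 0 ≤ adjoint A * (adjoint A * A - A * adjoint A) * A) (v : H) :
    ‖adjoint A (A v)‖ ≤ ‖A (A v)‖ := by
  have h1 := ((nonneg_iff_isPositive _).1 hA).inner_nonneg_right v
  have e : (adjoint A * (adjoint A * A - A * adjoint A) * A) v =
    adjoint A (adjoint A (A (A v)) - A (adjoint A (A v))) := rfl
  rw [e, adjoint_inner_right, inner_sub_right, adjoint_inner_right, ← adjoint_inner_left A (adjoint A (A v)),
    inner_self_eq_norm_sq_to_K, inner_self_eq_norm_sq_to_K] at h1
  refine le_of_sq_le_sq ?_ (norm_nonneg _)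
  have h2 : (0 : ℂ) ≤ ((‖A (A v)‖ ^ 2 - ‖adjoint A (A v)‖ ^ 2 : ℝ) : ℂ) := by
    push_cast; exact h1
  have h3 := Complex.zero_le_real.1 h2
  linarith

lemma pb_zero (A B : H →L[ℂ] H)
    (hA : 0 ≤ adjoint A * (adjoint A * A - A * adjoint A) * A)
    (h1 : adjoint B * A = A * adjoint B) (h1' : adjoint A * B = B * adjoint A)
    (h3 : adjoint B * (adjoint A * A - A * adjoint A) * B = 0) :
    (adjoint A * A - A * adjoint A) * B = 0 := by
  have hc : ∀ x, adjoint A (B x) = B (adjoint A x) := fun x => DFunLike.congr_fun h1' x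
  have hc' : ∀ x, adjoint B (A x) = A (adjoint B x) := fun x => DFunLike.congr_fun h1 x
  have h3' : ∀ x, adjoint B (adjoint A (A (B x)) - A (adjoint A (B x))) = 0 :=
    fun x => DFunLike.congr_fun h3 x
  have hn : ∀ x, ‖A (B x)‖ ≤ ‖adjoint A (B x)‖ := by
    intro x
    have h5 : ⟪x, adjoint B (adjoint A (A (B x)) - A (adjoint A (B x)))⟫_ℂ = 0 := by
      rw [h3', inner_zero_right]
    rw [adjoint_inner_right, inner_sub_right, adjoint_inner_right, ← adjoint_inner_left A (adjoint A (B x)),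
      inner_self_eq_norm_sq_to_K, inner_self_eq_norm_sq_to_K, sub_eq_zero] at h5
    refine le_of_sq_le_sq (le_of_eq ?_) (norm_nonneg _)
    exact_mod_cast h5
  have hst := star_lemma A B (norm_of_nonneg A hA) hc hn
  ext x
  change adjoint A (A (B x)) - A (adjoint A (B x)) = 0
  have hw := h3' x
  set w := adjoint A (A (B x)) - A (adjoint A (B x)) with hwdef
  have a1 : ⟪w, A (adjoint A (B x))⟫_ℂ = 0 := by
    rw [hc, ← adjoint_inner_left, ← adjoint_inner_left, hst w hw, inner_zero_left]
  have a2 : ⟪w, adjoint A (A (B x))⟫_ℂ = 0 := by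
    rw [adjoint_inner_right, ← adjoint_inner_left A, ← adjoint_inner_left B,
      hst (A w) (by rw [hc', hw, map_zero]), inner_zero_left]
  rw [← inner_self_eq_zero (𝕜 := ℂ)]
  conv_lhs => rw [hwdef]
  rw [← hwdef, ← inner_conj_symm, inner_sub_right, a1, a2]
  simp

lemma final_id (A B : H →L[ℂ] H)
    (hA : 0 ≤ adjoint A * (adjoint A * A - A * adjoint A) * A)
    (hB : 0 ≤ adjoint B * B - B * adjoint B)
    (h1 : adjoint B * A - A * adjoint B = 0)
    (h2 : adjoint A * (adjoint B * B - B * adjoint B) * B = 0)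
    (h3 : adjoint B * (adjoint A * A - A * adjoint A) * B = 0) :
    ∀ ω : ℂ,
      0 ≤ adjoint (ω • A + B) *
          (adjoint (ω • A + B) * (ω • A + B) - (ω • A + B) * adjoint (ω • A + B)) *
          (ω • A + B) := by
  intro ω
  have c1 : adjoint B * A = A * adjoint B := sub_eq_zero.1 h1
  have c2 : adjoint A * B = B * adjoint A := by
    have := congrArg star c1
    simp only [star_mul, star_eq_adjoint, adjoint_adjoint] at this
    exact this
  have p1 := pb_zero A B hA c1 c2 h3
  have p2 : adjoint B * (adjoint A * A - A * adjoint A) = 0 := by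
    have := congrArg star p1
    simp only [star_mul, star_sub, star_eq_adjoint, adjoint_adjoint, map_zero] at this
    exact this
  have q2 : adjoint B * (adjoint B * B - B * adjoint B) * A = 0 := by
    have := congrArg star h2
    simp only [star_mul, star_sub, star_eq_adjoint, adjoint_adjoint, map_zero] at this
    rw [mul_assoc]
    exact this
  have hT : adjoint (ω • A + B) = (starRingEnd ℂ ω) • adjoint A + adjoint B := by
    simp [← star_eq_adjoint]
  have hcomm : adjoint (ω • A + B) * (ω • A + B) - (ω • A + B) * adjoint (ω • A + B) =
      (starRingEnd ℂ ω * ω) • (adjoint A * A - A * adjoint A)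
        + (adjoint B * B - B * adjoint B) := by
    rw [hT]
    simp only [mul_add, add_mul, smul_mul_assoc, mul_smul_comm, smul_sub, c1, c2]
    module
  rw [hcomm, hT]
  set P := adjoint A * A - A * adjoint A
  set Q := adjoint B * B - B * adjoint B
  have hω : starRingEnd ℂ ω * ω = ((‖ω‖ ^ 2 : ℝ) : ℂ) := by
    rw [Complex.conj_mul']; push_cast; rfl
  have e : ((starRingEnd ℂ) ω • adjoint A + adjoint B) * ((starRingEnd ℂ ω * ω) • P + Q)
      * (ω • A + B) = ((starRingEnd ℂ ω * ω) * (starRingEnd ℂ ω * ω)) • (adjoint A * P * A)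
        + (starRingEnd ℂ ω * ω) • (adjoint A * Q * A) + adjoint B * Q * B := by
    simp only [mul_add, add_mul, smul_mul_assoc, mul_smul_comm]
    simp only [p2, h2, q2, mul_assoc (adjoint A) P B, p1, mul_zero, zero_mul, smul_zero, add_zero,
      zero_add]
    module
  rw [e, hω, ← Complex.ofReal_mul]
  have hs : ∀ (r : ℝ) (X : H →L[ℂ] H), 0 ≤ r → 0 ≤ X → 0 ≤ (r : ℂ) • X := fun r X hr hX => by
    rw [Complex.coe_smul]
    exact smul_nonneg hr hX
  refine add_nonneg (add_nonneg (hs _ _ (by positivity) hA) (hs _ _ (by positivity) ?_)) ?_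
  · exact star_left_conjugate_nonneg hB A
  · exact star_left_conjugate_nonneg hB B

/-- A quasihyponormal, B hyponormal, [B*,A] = 0, A*[B*,B]B = 0, B*[A*,A]B = 0 ⟹
ωA + B is quasihyponormal for every ω ∈ ℂ. -/
theorem stmt11 (A B : H →L[ℂ] H)
    (hA : 0 ≤ adjoint A * (adjoint A * A - A * adjoint A) * A)
    (hB : 0 ≤ adjoint B * B - B * adjoint B)
    (h1 : adjoint B * A - A * adjoint B = 0)
    (h2 : adjoint A * (adjoint B * B - B * adjoint B) * B = 0)
    (h3 : adjoint B * (adjoint A * A - A * adjoint A) * B = 0) :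
    ∀ ω : ℂ,
      0 ≤ adjoint (ω • A + B) *
          (adjoint (ω • A + B) * (ω • A + B) - (ω • A + B) * adjoint (ω • A + B)) *
          (ω • A + B) := by
  exact final_id A B hA hB h1 h2 h3
end

section
/- Let A and B be quasihyponormal bounded operators on a complex Hilbert space. If [B*,A] = 0, A*[B*,B]B = 0, B*[A*,A]B = 0 and A*[B*,B]A = 0, then ωA + B is quasihyponormal for every complex number ω. -/
open ContinuousLinearMap
open scoped InnerProductSpace
variable {H : Type*} [NormedAddCommGroup H] [InnerProductSpace ℂ H] [CompleteSpace H]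

theorem lemD (T : H →L[ℂ] H) (y : H) (M : ℝ) (hM : 0 ≤ M)
    (h : ∀ x, ‖⟪y, x⟫_ℂ‖ ≤ M * ‖T x‖) :
    ∃ p ∈ closure (Set.range T), ‖p‖ ≤ M ∧ ∀ x, ⟪p, T x⟫_ℂ = ⟪y, x⟫_ℂ := by
  classical
  let Rg := LinearMap.range T.toLinearMap
  have hs : ∀ w : Rg, ∃ x, T x = w := fun w => w.2
  choose s hs using hs
  have key : ∀ a b, T a = T b → ⟪y, a⟫_ℂ = ⟪y, b⟫_ℂ := by
    intro a b hab
    have := h (a - b)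
    rw [map_sub, hab, sub_self, norm_zero, mul_zero, inner_sub_right] at this
    exact sub_eq_zero.mp (norm_le_zero_iff.mp this)
  let f0 : Rg →ₗ[ℂ] ℂ :=
    { toFun := fun w => ⟪y, s w⟫_ℂ
      map_add' := by
        intro a b
        rw [← inner_add_right]
        apply key
        simp [hs]
      map_smul' := by
        intro c a
        simp only [RingHom.id_apply, smul_eq_mul]
        rw [← inner_smul_right]
        apply key
        simp [hs] }
  let f : Rg →L[ℂ] ℂ := f0.mkContinuous M (by
    intro w
    have := h (s w)
    rw [hs] at this
    exact this)
  have hfn : ‖f‖ ≤ M := LinearMap.mkContinuous_norm_le _ hM _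
  obtain ⟨F, hF, hFn⟩ := exists_extension_norm_eq (𝕜 := ℂ) Rg f
  let p0 := (InnerProductSpace.toDual ℂ H).symm F
  have hp0 : ∀ x, ⟪p0, T x⟫_ℂ = ⟪y, x⟫_ℂ := by
    intro x
    have h1 : ⟪p0, T x⟫_ℂ = F (T x) := by
      simp only [p0, InnerProductSpace.toDual_symm_apply]
    rw [h1]
    have h2 := hF ⟨T x, x, rfl⟩
    simp only at h2
    rw [h2]
    exact key _ _ (hs _)
  have hp0n : ‖p0‖ ≤ M := by
    simp only [p0, LinearIsometryEquiv.norm_map]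
    rw [hFn]; exact hfn
  let K := Rg.topologicalClosure
  have : CompleteSpace K := Rg.isClosed_topologicalClosure.completeSpace_coe
  refine ⟨K.starProjection p0, ?_, ?_, ?_⟩
  · have : K.starProjection p0 ∈ K := K.starProjection_apply_mem p0
    exact this
  · exact (K.norm_starProjection_apply_le p0).trans hp0n
  · intro x
    rw [← hp0 x]
    have hx : T x ∈ K := Rg.le_topologicalClosure ⟨x, rfl⟩
    rw [Submodule.inner_starProjection_left_eq_right, Submodule.starProjection_eq_self_iff.mpr hx]

/-- norm identity -/
theorem norm_shift (A : H →L[ℂ] H) (μ : ℂ) (z : H) :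
    ‖A z - μ • z‖ ^ 2 - ‖adjoint A z - (starRingEnd ℂ μ) • z‖ ^ 2
      = ‖A z‖ ^ 2 - ‖adjoint A z‖ ^ 2 := by
  have : RCLike.re ⟪A z, μ • z⟫_ℂ = RCLike.re ⟪adjoint A z, (starRingEnd ℂ μ) • z⟫_ℂ := by
    rw [inner_smul_right, inner_smul_right, adjoint_inner_left, ← inner_conj_symm,
      ← RCLike.conj_re]
    simp
  have hn : ‖(starRingEnd ℂ μ) • z‖ = ‖μ • z‖ := by simp [norm_smul]
  rw [@norm_sub_sq ℂ, @norm_sub_sq ℂ, this, hn]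
  ring

theorem growth_zero (a C : ℝ) (ha : 0 ≤ a) (h : ∀ l : ℂ, ‖l‖ * a ≤ C) : a = 0 := by
  by_contra hne
  have hpos : 0 < a := lt_of_le_of_ne ha (Ne.symm hne)
  have hC : 0 ≤ C := by simpa using h 0
  have h1 := h (((C + 1) / a : ℝ) : ℂ)
  rw [Complex.norm_real, Real.norm_eq_abs, abs_of_nonneg (by positivity),
    div_mul_cancel₀ _ hne] at h1
  linarith

theorem lemK (A : H →L[ℂ] H) (hA : ∀ x, ‖adjoint A (A x)‖ ≤ ‖A (A x)‖)
    (q : ℂ → H) (y : H) (M : ℝ) (hM : ∀ l, ‖A (q l)‖ ≤ M)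
    (hq : ∀ l, A (A (q l)) - l • A (q l) = y) : y = 0 := by
  have hM0 : 0 ≤ M := (norm_nonneg _).trans (hM 0)
  -- hyponormality estimate on the range
  have hyp : ∀ (μ : ℂ) (w x : H),
      ‖⟪A w - μ • w, A x⟫_ℂ‖ ≤ ‖w‖ * ‖A (A x) - μ • A x‖ := by
    intro μ w x
    have e : ⟪A w - μ • w, A x⟫_ℂ = ⟪w, adjoint A (A x) - (starRingEnd ℂ μ) • A x⟫_ℂ := by
      rw [inner_sub_left, inner_sub_right, adjoint_inner_right, inner_smul_left, inner_smul_right]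
    rw [e]
    refine (norm_inner_le_norm _ _).trans ?_
    gcongr
    have h1 := norm_shift A μ (A x)
    have h2 := hA x
    have h3 : ‖adjoint A (A x)‖ ^ 2 ≤ ‖A (A x)‖ ^ 2 := by gcongr
    exact (sq_le_sq₀ (norm_nonneg _) (norm_nonneg _)).mp (by linarith)
  let g : ℂ → H := fun l => A (q l)
  have hdiff : ∀ μ l, A (g l - g μ) - μ • (g l - g μ) = (l - μ) • g l := by
    intro μ l
    have h1 := hq l
    have h2 := hq μ
    simp only [g, map_sub, smul_sub, sub_smul]
    rw [sub_eq_iff_eq_add] at h1 h2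
    rw [h1, h2]; abel
  let φ : ℂ → ℂ := fun l => ⟪y, g l⟫_ℂ
  have hD : Differentiable ℂ φ := by
    intro μ
    let T : H →L[ℂ] H := (A - μ • ContinuousLinearMap.id ℂ H) ∘L A
    have hT : ∀ x, T x = A (A x) - μ • A x := fun x => by simp [T]
    obtain ⟨p, hpc, hpM, hp⟩ := lemD T (adjoint A y) M hM0 (by
      intro x
      rw [adjoint_inner_left, hT, ← hq μ]
      refine (hyp μ _ x).trans ?_
      gcongr
      exact hM μ)
    have hquot : ∀ l, φ l - φ μ = (l - μ) * ⟪p, g l⟫_ℂ := by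
      intro l
      have h1 := hp (q l - q μ)
      rw [hT, adjoint_inner_left, map_sub A (q l)] at h1
      have h2 := hdiff μ l
      simp only [g] at h2
      rw [h2, inner_smul_right, inner_sub_right] at h1
      exact h1.symm
    -- weak continuity against p
    have hcont : Filter.Tendsto (fun l => ⟪p, g l⟫_ℂ) (nhds μ) (nhds ⟪p, g μ⟫_ℂ) := by
      rw [Metric.tendsto_nhds]
      intro ε hε
      obtain ⟨r, ⟨x, rfl⟩, hr⟩ := Metric.mem_closure_iff.mp hpc (ε / (2 * (2 * M + 1)))
        (by positivity)
      have hev : ∀ᶠ l in nhds μ, ‖A x‖ * (‖l - μ‖ * M) < ε / 2 := by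
        have : Filter.Tendsto (fun l : ℂ => ‖A x‖ * (‖l - μ‖ * M)) (nhds μ)
            (nhds (‖A x‖ * (‖μ - μ‖ * M))) := by
          apply Continuous.tendsto
          fun_prop
        simp only [sub_self, norm_zero, zero_mul, mul_zero] at this
        exact this.eventually_lt_const (by positivity)
      filter_upwards [hev] with l hl
      rw [dist_eq_norm, ← inner_sub_right]
      have e : ⟪p, g l - g μ⟫_ℂ = ⟪p - T x, g l - g μ⟫_ℂ + ⟪T x, g l - g μ⟫_ℂ := by
        rw [← inner_add_left, sub_add_cancel]
      have b1 : ‖⟪p - T x, g l - g μ⟫_ℂ‖ ≤ ε / (2 * (2 * M + 1)) * (2 * M) := by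
        refine (norm_inner_le_norm _ _).trans ?_
        rw [dist_eq_norm] at hr
        gcongr
        refine (norm_sub_le _ _).trans ?_
        have := hM l
        have := hM μ
        simp only [g]; linarith
      have b2 : ‖⟪T x, g l - g μ⟫_ℂ‖ ≤ ‖A x‖ * (‖l - μ‖ * M) := by
        have h1 := hyp μ (A x) (q l - q μ)
        have h2 := hdiff μ l
        simp only [g] at h2
        rw [map_sub A (q l), h2, norm_smul] at h1
        rw [hT]
        refine h1.trans ?_
        gcongr
        exact hM l
      have b3 : ε / (2 * (2 * M + 1)) * (2 * M) ≤ ε / 2 := by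
        rw [div_mul_eq_mul_div, div_le_div_iff₀ (by positivity) (by positivity)]
        nlinarith
      rw [e]
      refine (norm_add_le _ _).trans_lt ?_
      linarith
    have : HasDerivAt φ ⟪p, g μ⟫_ℂ μ := by
      rw [hasDerivAt_iff_tendsto_slope]
      refine (hcont.mono_left nhdsWithin_le_nhds).congr' ?_
      filter_upwards [self_mem_nhdsWithin] with l hl
      have hne : l - μ ≠ 0 := sub_ne_zero.mpr hl
      rw [slope_def_field, hquot l]
      field_simp
    exact this.differentiableAt
  have hB : Bornology.IsBounded (Set.range φ) := by
    rw [isBounded_iff_forall_norm_le]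
    refine ⟨‖y‖ * M, ?_⟩
    rintro _ ⟨l, rfl⟩
    refine (norm_inner_le_norm _ _).trans ?_
    gcongr
    exact hM l
  have hconst : ∀ l, φ l = φ 0 := fun l => hD.apply_eq_apply_of_bounded hB l 0
  -- l * φ l = ⟪y, A g l⟫ - ‖y‖^2
  have hmul : ∀ l, l * φ l = ⟪y, A (g l)⟫_ℂ - ⟪y, y⟫_ℂ := by
    intro l
    have h1 := hq l
    rw [← inner_sub_right]
    simp only [φ]
    rw [← inner_smul_right]
    congr 1
    simp only [g]
    rw [← h1]; abel
  have hAg : ∀ l, ‖A (g l)‖ ≤ ‖A‖ * M := fun l =>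
    (A.le_opNorm _).trans (by gcongr; exact hM l)
  have hc0 : ‖φ 0‖ = 0 := by
    apply growth_zero _ (‖y‖ * (‖A‖ * M) + ‖y‖ * ‖y‖) (norm_nonneg _)
    intro l
    rw [← norm_mul, ← hconst l, hmul l]
    refine (norm_sub_le _ _).trans ?_
    gcongr
    · refine (norm_inner_le_norm _ _).trans ?_
      gcongr
      exact hAg l
    · exact norm_inner_le_norm _ _
  have hyy : ∀ l, ⟪y, A (g l)⟫_ℂ = ⟪y, y⟫_ℂ := by
    intro l
    have := hmul l
    rw [hconst l, norm_eq_zero.mp hc0, mul_zero] at this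
    exact (sub_eq_zero.mp this.symm)
  have hfin : ‖⟪y, y⟫_ℂ‖ = 0 := by
    apply growth_zero _ (‖y‖ * (‖A‖ * (‖A‖ * M + ‖y‖))) (norm_nonneg _)
    intro l
    rw [← norm_mul, ← hyy l, ← inner_smul_right, ← map_smul]
    refine (norm_inner_le_norm _ _).trans ?_
    gcongr
    refine (A.le_opNorm _).trans ?_
    gcongr
    have e : l • g l = A (g l) - y := by
      simp only [g]; rw [← hq l]; abel
    rw [e]
    refine (norm_sub_le _ _).trans ?_
    gcongr
    exact hAg l
  exact inner_self_eq_zero.mp (norm_eq_zero.mp hfin)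

theorem lem5 (A B : H →L[ℂ] H) (hA : ∀ x, ‖adjoint A (A x)‖ ≤ ‖A (A x)‖)
    (hN : ∀ x, ‖A (B x)‖ = ‖adjoint A (B x)‖)
    (c1 : ∀ x, adjoint B (A x) = A (adjoint B x))
    (c2 : ∀ x, adjoint A (B x) = B (adjoint A x))
    (u : H) (hu : A (adjoint B u) = 0) : A (adjoint B (adjoint A u)) = 0 := by
  have hW : ∀ v x, ⟪A (adjoint B v), x⟫_ℂ = ⟪v, B (adjoint A x)⟫_ℂ := by
    intro v x
    rw [← adjoint_inner_right, adjoint_inner_left]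
  have key : ∀ l : ℂ, ∃ p, ‖p‖ ≤ ‖u‖ ∧
      A (A (adjoint B p)) - l • A (adjoint B p) = A (adjoint B (adjoint A u)) := by
    intro l
    let T : H →L[ℂ] H := (adjoint A - (starRingEnd ℂ l) • ContinuousLinearMap.id ℂ H) ∘L
      (B ∘L adjoint A)
    have hT : ∀ x, T x = adjoint A (B (adjoint A x)) - (starRingEnd ℂ l) • B (adjoint A x) :=
      fun x => by simp [T]
    obtain ⟨p, -, hpn, hp⟩ := lemD T (A (adjoint B (adjoint A u))) ‖u‖ (norm_nonneg _) (by
      intro x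
      have e : ⟪A (adjoint B (adjoint A u)), x⟫_ℂ
          = ⟪u, A (B (adjoint A x)) - l • B (adjoint A x)⟫_ℂ := by
        rw [inner_sub_right, inner_smul_right, ← hW u, hu, inner_zero_left, mul_zero, sub_zero,
          hW, adjoint_inner_left]
      rw [e]
      refine (norm_inner_le_norm _ _).trans ?_
      gcongr
      rw [hT]
      have h1 := norm_shift A l (B (adjoint A x))
      rw [hN, sub_self] at h1
      exact (sq_le_sq₀ (norm_nonneg _) (norm_nonneg _)).mp (by linarith))
    refine ⟨p, hpn, ?_⟩
    apply ext_inner_right ℂ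
    intro x
    rw [← hp x, hT, inner_sub_left, inner_sub_right, inner_smul_left, inner_smul_right, ← hW p,
      adjoint_inner_right, ← hW, c1]
  choose p hpn hp using key
  refine lemK A hA (fun l => adjoint B (p l)) _ (‖A‖ * (‖adjoint B‖ * ‖u‖)) ?_ hp
  intro l
  refine (A.le_opNorm _).trans ?_
  gcongr
  refine ((adjoint B).le_opNorm _).trans ?_
  gcongr
  exact hpn l

theorem lem6 (A B : H →L[ℂ] H) (hA : ∀ x, ‖adjoint A (A x)‖ ≤ ‖A (A x)‖)
    (hN : ∀ x, ‖A (B x)‖ = ‖adjoint A (B x)‖)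
    (h3 : ∀ x, adjoint B (adjoint A (A (B x)) - A (adjoint A (B x))) = 0)
    (c1 : ∀ x, adjoint B (A x) = A (adjoint B x))
    (c2 : ∀ x, adjoint A (B x) = B (adjoint A x)) (x : H) :
    adjoint A (A (B (adjoint A x))) - A (adjoint A (B (adjoint A x))) = 0 := by
  have hW : ∀ v x, ⟪A (adjoint B v), x⟫_ℂ = ⟪v, B (adjoint A x)⟫_ℂ := by
    intro v x
    rw [← adjoint_inner_right, adjoint_inner_left]
  obtain ⟨u, hu⟩ : ∃ u, u = adjoint A (A (B (adjoint A x))) - A (adjoint A (B (adjoint A x))) :=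
    ⟨_, rfl⟩
  rw [← hu]
  have hu0 : A (adjoint B u) = 0 := by rw [hu, h3, map_zero]
  have hu1 := lem5 A B hA hN c1 c2 u hu0
  have hu2 := lem5 A B hA hN c1 c2 (A u) (by rw [c1, hu0, map_zero])
  have e : ⟪u, u⟫_ℂ = 0 := by
    nth_rewrite 2 [hu]
    rw [inner_sub_right, adjoint_inner_right, ← adjoint_inner_left, ← hW, hu2,
      ← adjoint_inner_left, c2, ← hW, hu1]
    simp
  exact inner_self_eq_zero.mp e

theorem lem7 (A B : H →L[ℂ] H) (hA : ∀ x, ‖adjoint A (A x)‖ ≤ ‖A (A x)‖)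
    (hN : ∀ x, ‖A (B x)‖ = ‖adjoint A (B x)‖)
    (h3 : ∀ x, adjoint B (adjoint A (A (B x)) - A (adjoint A (B x))) = 0)
    (c1 : ∀ x, adjoint B (A x) = A (adjoint B x))
    (c2 : ∀ x, adjoint A (B x) = B (adjoint A x)) :
    (adjoint A * A - A * adjoint A) * B = 0 := by
  obtain ⟨V, hV⟩ : ∃ V, V = (adjoint A * A - A * adjoint A) * B := ⟨_, rfl⟩
  have hVx : ∀ x, V x = adjoint A (A (B x)) - A (adjoint A (B x)) := fun x => by
    rw [hV]; simp
  rw [← hV]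
  have hVA : ∀ x, V (adjoint A x) = 0 := fun x => by
    rw [hVx]; exact lem6 A B hA hN h3 c1 c2 x
  have hVk : ∀ x, adjoint A x = 0 → V x = 0 := by
    intro x hx
    have h5 : adjoint A (B x) = 0 := by rw [c2, hx, map_zero]
    have h6 : A (B x) = 0 := by
      rw [← norm_eq_zero, hN, h5, norm_zero]
    rw [hVx, h5, h6]; simp
  have hcl : ∀ t ∈ closure (Set.range A), ‖adjoint A t‖ ≤ ‖A t‖ := by
    intro t ht
    have hc : IsClosed {t | ‖adjoint A t‖ ≤ ‖A t‖} :=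
      isClosed_le (by fun_prop) (by fun_prop)
    refine closure_minimal ?_ hc ht
    rintro _ ⟨x, rfl⟩
    exact hA x
  have hVs : adjoint V = 0 := by
    ext v
    simp only [zero_apply]
    obtain ⟨t, ht⟩ : ∃ t, t = adjoint V v := ⟨_, rfl⟩
    rw [← ht]
    have hAt : A t = 0 := by
      apply ext_inner_right ℂ
      intro x
      rw [← adjoint_inner_right, ht, adjoint_inner_left, hVA]; simp
    have hperp : ∀ x, adjoint A x = 0 → ⟪x, t⟫_ℂ = 0 := by
      intro x hx
      rw [ht, adjoint_inner_right, hVk x hx, inner_zero_left]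
    have hmem : t ∈ (LinearMap.range A.toLinearMap).topologicalClosure := by
      rw [← Submodule.orthogonal_orthogonal_eq_closure, Submodule.mem_orthogonal]
      intro x hx
      apply hperp
      apply ext_inner_right ℂ
      intro z
      rw [adjoint_inner_left, inner_zero_left]
      exact (Submodule.mem_orthogonal' _ _).mp hx _ ⟨z, rfl⟩
    have h8 := hcl t hmem
    rw [hAt, norm_zero, norm_le_zero_iff] at h8
    exact inner_self_eq_zero.mp (hperp t h8)
  have := congrArg adjoint hVs
  simpa using this

open scoped ComplexOrder in
theorem smul_pos_aux (c : ℂ) (T : H →L[ℂ] H) (hc : ∃ r : ℝ, 0 ≤ r ∧ c = r) (hT : 0 ≤ T) :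
    0 ≤ c • T := by
  obtain ⟨r, hr, rfl⟩ := hc
  rw [nonneg_iff_isPositive] at hT ⊢
  exact hT.smul_of_nonneg (by exact_mod_cast hr)

/-- A, B quasihyponormal, [B*,A] = 0, A*[B*,B]B = 0, B*[A*,A]B = 0, A*[B*,B]A = 0 ⟹
ωA + B is quasihyponormal for every ω ∈ ℂ. -/
theorem stmt12 (A B : H →L[ℂ] H)
    (hA : 0 ≤ adjoint A * (adjoint A * A - A * adjoint A) * A)
    (hB : 0 ≤ adjoint B * (adjoint B * B - B * adjoint B) * B)
    (h1 : adjoint B * A - A * adjoint B = 0)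
    (h2 : adjoint A * (adjoint B * B - B * adjoint B) * B = 0)
    (h3 : adjoint B * (adjoint A * A - A * adjoint A) * B = 0)
    (h4 : adjoint A * (adjoint B * B - B * adjoint B) * A = 0) :
    ∀ ω : ℂ,
      0 ≤ adjoint (ω • A + B) *
          (adjoint (ω • A + B) * (ω • A + B) - (ω • A + B) * adjoint (ω • A + B)) *
          (ω • A + B) := by
  have c1' : adjoint B * A = A * adjoint B := sub_eq_zero.mp h1
  have c2' : adjoint A * B = B * adjoint A := by
    have := congrArg star c1'
    simpa [← star_eq_adjoint] using this
  have c1 : ∀ x, adjoint B (A x) = A (adjoint B x) := fun x => DFunLike.congr_fun c1' x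
  have c2 : ∀ x, adjoint A (B x) = B (adjoint A x) := fun x => DFunLike.congr_fun c2' x
  have h3' : ∀ x, adjoint B (adjoint A (A (B x)) - A (adjoint A (B x))) = 0 :=
    fun x => DFunLike.congr_fun h3 x
  have expand : ∀ (S : H →L[ℂ] H) (x : H),
      RCLike.re ⟪x, adjoint S (adjoint A (A (S x)) - A (adjoint A (S x)))⟫_ℂ
        = ‖A (S x)‖ ^ 2 - ‖adjoint A (S x)‖ ^ 2 := by
    intro S x
    rw [adjoint_inner_right, inner_sub_right, adjoint_inner_right, ← adjoint_inner_left A (adjoint A (S x)), map_sub,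
      inner_self_eq_norm_sq, inner_self_eq_norm_sq]
  have hA' : ∀ x, ‖adjoint A (A x)‖ ≤ ‖A (A x)‖ := by
    intro x
    have h := ((nonneg_iff_isPositive _).mp hA).re_inner_nonneg_right x
    have h' := expand A x
    have h'' : 0 ≤ ‖A (A x)‖ ^ 2 - ‖adjoint A (A x)‖ ^ 2 := by rw [← h']; exact h
    exact (sq_le_sq₀ (norm_nonneg _) (norm_nonneg _)).mp (by linarith)
  have hN : ∀ x, ‖A (B x)‖ = ‖adjoint A (B x)‖ := by
    intro x
    have h' := expand B x
    rw [h3', inner_zero_right, map_zero] at h'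
    exact (sq_eq_sq₀ (norm_nonneg _) (norm_nonneg _)).mp (by linarith)
  have hPB := lem7 A B hA' hN h3' c1 c2
  have hBP : adjoint B * (adjoint A * A - A * adjoint A) = 0 := by
    have := congrArg star hPB
    simpa [← star_eq_adjoint] using this
  have h2' : adjoint B * (adjoint B * B - B * adjoint B) * A = 0 := by
    have := congrArg star h2
    simpa [← star_eq_adjoint, mul_assoc] using this
  intro ω
  have hadj : adjoint (ω • A + B) = (starRingEnd ℂ ω) • adjoint A + adjoint B := by
    simp only [← star_eq_adjoint, star_add, star_smul]
    rfl
  rw [hadj]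
  obtain ⟨P, hP⟩ : ∃ P, P = adjoint A * A - A * adjoint A := ⟨_, rfl⟩
  obtain ⟨Q, hQ⟩ : ∃ Q, Q = adjoint B * B - B * adjoint B := ⟨_, rfl⟩
  have hcomm : ((starRingEnd ℂ ω) • adjoint A + adjoint B) * (ω • A + B)
      - (ω • A + B) * ((starRingEnd ℂ ω) • adjoint A + adjoint B)
      = (ω * starRingEnd ℂ ω) • P + Q := by
    rw [hP, hQ]
    simp only [mul_add, add_mul, smul_mul_assoc, mul_smul_comm, smul_smul, smul_add, smul_sub, c1', c2',
      mul_comm (starRingEnd ℂ ω) ω]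
    abel
  rw [hcomm]
  rw [← hP] at hA hPB hBP
  rw [← hQ] at hB h2 h2' h4
  have hfinal : ((starRingEnd ℂ ω) • adjoint A + adjoint B) * ((ω * starRingEnd ℂ ω) • P + Q)
      * (ω • A + B)
      = ((ω * starRingEnd ℂ ω) * (ω * starRingEnd ℂ ω)) • (adjoint A * P * A)
        + adjoint B * Q * B := by
    have hPB2 : adjoint A * P * B = 0 := by rw [mul_assoc, hPB, mul_zero]
    simp only [mul_add, add_mul, smul_mul_assoc, mul_smul_comm, smul_smul, hBP, hPB2, h2, h2', h4,
      smul_zero, zero_mul, add_zero, zero_add]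
    congr 2
    ring
  rw [hfinal]
  refine add_nonneg (smul_pos_aux _ _ ?_ hA) hB
  rw [Complex.mul_conj, ← Complex.ofReal_mul]
  exact ⟨_, mul_self_nonneg _, rfl⟩
end
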